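/- Let x, κ, θ, η ∈ ℝ and set σ^OU := (x·𝟙 + κθ·e_1 + η·e_2) ⊗ exp_⧢(−κ·e_1) ∈ T((ℝ²)). Then (σ^OU − θ·𝟙) ⧢ exp_⧢(κ·e_1) = (x − θ)·𝟙 + η·(exp_⧢(κ·e_1) ⊗ e_2). -/

import Mathlib

/-- Words over the alphabet `{1, …, d}`, modeled as lists over `Fin d`. -/
abbrev Word (d : ℕ) := List (Fin d)

/-- The extended tensor algebra `T((ℝ^d))`, modeled as real-valued functions on words. -/
abbrev Tensor (d : ℕ) := Word d → ℝ

namespace Sig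

/-- The unit `𝟙`: the indicator of the empty word. -/
def unit (d : ℕ) : Tensor d := fun w => if w = [] then 1 else 0

/-- The concatenation product `(ℓ ⊗ p)(w) = Σ_{w = u·v} ℓ(u) p(v)`. -/
def concatProd {d : ℕ} (l p : Tensor d) : Tensor d :=
  fun w => ∑ i ∈ Finset.range (w.length + 1), l (w.take i) * p (w.drop i)

/-- `n`-fold concatenation power, `ℓ^⊗0 = 𝟙`. -/
def concatPow {d : ℕ} (l : Tensor d) : ℕ → Tensor d
  | 0 => unit d
  | n + 1 => concatProd (concatPow l n) l

/-- The letter `e_i`: the indicator of the one-letter word `i`. -/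
def letter {d : ℕ} (i : Fin d) : Tensor d := fun w => if w = [i] then 1 else 0

/-- The shuffle product on `T((ℝ^d))`, the coefficientwise bilinear extension of the
inductive shuffle of words. -/
def shuffle {d : ℕ} : Tensor d → Tensor d → Word d → ℝ
  | l, m, [] => l [] * m []
  | l, m, i :: w => shuffle (fun u => l (i :: u)) m w + shuffle l (fun u => m (i :: u)) w

/-- `n`-fold shuffle power, `ℓ^⧢0 = 𝟙`. -/
def shufflePow {d : ℕ} (l : Tensor d) : ℕ → Tensor d
  | 0 => unit d
  | n + 1 => shuffle (shufflePow l n) l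

/-- The resolvent `(𝟙 − q)^{-1} = Σ_{n≥0} q^⊗n`, defined coefficientwise. -/
noncomputable def resolvent {d : ℕ} (q : Tensor d) : Tensor d :=
  fun w => ∑' n : ℕ, concatPow q n w

/-- The shuffle exponential `exp_⧢(ℓ) = Σ_{n≥0} ℓ^⧢n / n!`, defined coefficientwise. -/
noncomputable def shuffleExp {d : ℕ} (l : Tensor d) : Tensor d :=
  fun w => ∑' n : ℕ, shufflePow l n w / (n.factorial : ℝ)

/-- Right-deconcatenation (projection) by a word `u`: `(ℓ π_u)(w) = ℓ(w·u)`. -/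
def proj {d : ℕ} (l : Tensor d) (u : Word d) : Tensor d := fun w => l (w ++ u)

/-- The tensor-algebra representation of the Ornstein–Uhlenbeck process:
`σ^OU = (x·𝟙 + κθ·e_1 + η·e_2) ⊗ exp_⧢(−κ·e_1)`. -/
noncomputable def sigmaOU (x kappa theta eta : ℝ) : Tensor 2 :=
  concatProd
    (x • unit 2 + (kappa * theta) • letter (0 : Fin 2) + eta • letter (1 : Fin 2))
    (shuffleExp ((-kappa) • letter (0 : Fin 2)))

theorem shuffle_smul_left {d : ℕ} (c : ℝ) (w : Word d) : ∀ l m : Tensor d,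
    shuffle (fun u => c * l u) m w = c * shuffle l m w := by
  induction w with
  | nil => intro l m; simp only [shuffle]; ring
  | cons i w ih =>
    intro l m
    simp only [shuffle]
    rw [ih (fun u => l (i :: u)), ih l]; ring

theorem shuffle_smul_right {d : ℕ} (c : ℝ) (w : Word d) : ∀ l m : Tensor d,
    shuffle l (fun u => c * m u) w = c * shuffle l m w := by
  induction w with
  | nil => intro l m; simp only [shuffle]; ring
  | cons i w ih =>
    intro l m
    simp only [shuffle]
    rw [ih _ (fun u => m (i :: u)), ih _ m]; ring

theorem shuffle_zero_left {d : ℕ} (w : Word d) (m : Tensor d) :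
    shuffle (fun _ => 0) m w = 0 := by
  simpa using shuffle_smul_left 0 w (fun _ => 0) m

theorem shuffle_zero_right {d : ℕ} (w : Word d) (l : Tensor d) :
    shuffle l (fun _ => 0) w = 0 := by
  simpa using shuffle_smul_right 0 w l (fun _ => 0)

theorem shuffle_unit_right {d : ℕ} (w : Word d) : ∀ l : Tensor d,
    shuffle l (unit d) w = l w := by
  induction w with
  | nil => intro l; simp [shuffle, unit]
  | cons i w ih =>
    intro l
    have h : (fun u => unit d (i :: u)) = fun _ => 0 := by funext u; simp [unit]
    simp only [shuffle]
    rw [ih, h, shuffle_zero_right, add_zero]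

/-- Closed form of the shuffle exponential of `a • e_1`. -/
def expo (a : ℝ) : Tensor 2
  | [] => 1
  | i :: w => (if i = 0 then a else 0) * expo a w

theorem pow_cons (a : ℝ) (i : Fin 2) (n : ℕ) : ∀ w : Word 2,
    shufflePow (a • letter (0 : Fin 2)) (n + 1) (i :: w)
      = ((n + 1 : ℝ) * (if i = 0 then a else 0)) * shufflePow (a • letter (0 : Fin 2)) n w := by
  have hl : (fun u => (a • letter (0 : Fin 2)) (i :: u))
      = fun u => (if i = 0 then a else 0) * unit 2 u := by
    funext u
    by_cases h : i = 0 <;> simp [letter, unit, h]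
  induction n with
  | zero =>
    intro w
    have h : (fun u => unit 2 (i :: u)) = fun _ => 0 := by funext u; simp [unit]
    simp only [shufflePow, shuffle]
    rw [hl, h, shuffle_zero_left, shuffle_smul_right, shuffle_unit_right]
    simp
  | succ n ih =>
    intro w
    rw [shufflePow]
    simp only [shuffle]
    rw [hl, funext ih, shuffle_smul_left, shuffle_smul_right, shuffle_unit_right]
    rw [show shuffle (shufflePow (a • letter (0 : Fin 2)) n) (a • letter 0) w
      = shufflePow (a • letter (0 : Fin 2)) (n + 1) w from rfl]
    push_cast; ring

theorem pow_eq (a : ℝ) (w : Word 2) : ∀ n : ℕ,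
    shufflePow (a • letter (0 : Fin 2)) n w
      = if n = w.length then (n.factorial : ℝ) * expo a w else 0 := by
  induction w with
  | nil =>
    intro n
    cases n with
    | zero => simp [shufflePow, unit, expo]
    | succ n => simp [shufflePow, shuffle, letter]
  | cons i w ih =>
    intro n
    cases n with
    | zero => simp [shufflePow, unit]
    | succ n =>
      rw [pow_cons, ih]
      by_cases h : n = w.length
      · simp only [h, List.length_cons, if_true, expo, Nat.factorial_succ]
        push_cast; ring
      · simp [h]

theorem shuffleExp_eq (a : ℝ) : shuffleExp (a • letter (0 : Fin 2)) = expo a := by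
  funext w
  unfold shuffleExp
  rw [tsum_eq_single w.length]
  · rw [pow_eq, if_pos rfl]
    have : (w.length.factorial : ℝ) ≠ 0 := by positivity
    field_simp
  · intro n hn
    rw [pow_eq, if_neg hn, zero_div]

theorem expo_cons (a : ℝ) (i : Fin 2) :
    (fun u => expo a (i :: u)) = fun u => (if i = 0 then a else 0) * expo a u := rfl

theorem shuffle_expo (a : ℝ) (w : Word 2) : shuffle (expo (-a)) (expo a) w = unit 2 w := by
  cases w with
  | nil => simp [shuffle, expo, unit]
  | cons i w =>
    simp only [shuffle]
    rw [expo_cons, expo_cons, shuffle_smul_left, shuffle_smul_right]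
    by_cases h : i = 0 <;> simp [h, unit]

theorem concat_nil {d : ℕ} (l p : Tensor d) : concatProd l p [] = l [] * p [] := by
  simp [concatProd]

theorem concat_cons {d : ℕ} (l p : Tensor d) (i : Fin d) (w : Word d) :
    concatProd l p (i :: w) = concatProd (fun u => l (i :: u)) p w + l [] * p (i :: w) := by
  unfold concatProd
  rw [List.length_cons, Finset.sum_range_succ']
  simp

theorem concat_smul_left {d : ℕ} (c : ℝ) (l p : Tensor d) (w : Word d) :
    concatProd (fun u => c * l u) p w = c * concatProd l p w := by
  simp only [concatProd, Finset.mul_sum, mul_assoc]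

theorem concat_unit_left {d : ℕ} (p : Tensor d) (w : Word d) :
    concatProd (unit d) p w = p w := by
  cases w with
  | nil => simp [concat_nil, unit]
  | cons i w =>
    rw [concat_cons]
    simp [unit, concatProd]

theorem sigma_cons (x kappa theta eta : ℝ) (i : Fin 2) (w : Word 2) :
    sigmaOU x kappa theta eta (i :: w)
      = (if i = 0 then kappa * theta - kappa * x else eta) * expo (-kappa) w := by
  unfold sigmaOU
  rw [shuffleExp_eq, concat_cons]
  have h : (fun u => (x • unit 2 + (kappa * theta) • letter (0 : Fin 2)
      + eta • letter (1 : Fin 2)) (i :: u))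
      = fun u => (if i = 0 then kappa * theta else eta) * unit 2 u := by
    funext u
    fin_cases i <;> simp [unit, letter]
  rw [h, concat_smul_left, concat_unit_left]
  fin_cases i <;> simp [unit, letter, expo]
  ring

/-- `(σ^OU − θ·𝟙) ⧢ exp_⧢(κ·e_1) = (x − θ)·𝟙 + η·(exp_⧢(κ·e_1) ⊗ e_2)`. -/
theorem sigmaOU_time_dependent_rep (x kappa theta eta : ℝ) :
    shuffle (sigmaOU x kappa theta eta - theta • unit 2)
        (shuffleExp (kappa • letter (0 : Fin 2))) =
      (fun w => (x - theta) • unit 2 w +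
        eta • concatProd (shuffleExp (kappa • letter (0 : Fin 2))) (letter (1 : Fin 2)) w) := by
  rw [shuffleExp_eq]
  funext w
  induction w with
  | nil =>
    have h0 : sigmaOU x kappa theta eta [] = x := by
      unfold sigmaOU
      rw [shuffleExp_eq, concat_nil]
      simp [unit, letter, expo]
    simp [shuffle, h0, concat_nil, unit, letter, expo]
  | cons i w ih =>
    have h : (fun u => (sigmaOU x kappa theta eta - theta • unit 2) (i :: u))
        = fun u => (if i = 0 then kappa * theta - kappa * x else eta) * expo (-kappa) u := by
      funext u
      simp [sigma_cons, unit]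
    simp only [shuffle]
    rw [h, expo_cons, shuffle_smul_left, shuffle_smul_right, shuffle_expo, ih, concat_cons,
      expo_cons, concat_smul_left]
    fin_cases i <;> simp [unit, letter, expo]
    split_ifs <;> ring

end Sig
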